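/- arXiv:0907.3326 — 2 statements merged into one kernel-verified Lean document; each statement's English description precedes it below -/
import Mathlib

section
/- Let K be a field of characteristic 0 and W a K-vector space of dimension N+1. For an integer ℓ with 1 ≤ ℓ ≤ dim(W) − 1 and integers a, b with 0 ≤ b ≤ a ≤ ℓ, the assignment φ ↦ W_ℓ(φ) taking a degree-0 homomorphism φ : Ê(a) ⊗ H → Ê(b) ⊗ H' of graded free modules over the exterior algebra E = ⋀(W*) (with H, H' finite-dimensional K-vector spaces) to the associated graded A_ℓ-module homomorphism W_ℓ(φ) : ⋀^a K^ℓ ⊗ H ⊗ A_ℓ(−a) → ⋀^b K^ℓ ⊗ H' ⊗ A_ℓ(−b) is injective; that is, if W_ℓ(φ) = 0 then φ = 0. -/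
/-!
Statement 0 (Cox–Materov, "Tate Resolutions and Weyman Complexes").

Let `K` be a field of characteristic `0` and `W` a `K`-vector space of dimension `N+1`.
For `1 ≤ ℓ ≤ dim W − 1` and `0 ≤ b ≤ a ≤ ℓ`, the assignment `φ ↦ W_ℓ(φ)` is injective.

A degree-0 homomorphism `φ : Ê(a) ⊗ H → Ê(b) ⊗ H'` of graded free modules over the
exterior algebra `E = ⋀(W*)` is uniquely determined by the associated linear map
`φ̃₋ᵦ : H → ⋀^{a−b} W* ⊗ H'` (EFS, Prop. 5.6); we therefore identify `φ` with this map.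
The functor `W_ℓ` sends `φ` to the `A_ℓ`-module homomorphism
`W_ℓ(φ) : ⋀^a K^ℓ ⊗ H ⊗ A_ℓ(−a) → ⋀^b K^ℓ ⊗ H' ⊗ A_ℓ(−b)` determined in degree `a`
by the composition `(1 ⊗ Ψ ⊗ 1) ∘ (Φ ⊗ φ̃₋ᵦ)`, where `Φ` is the exterior
comultiplication and `Ψ : ⋀^{a−b} K^ℓ ⊗ ⋀^{a−b} W* → Sym^{a−b}(K^ℓ ⊗ W*) = (A_ℓ)_{a−b}`
is the Cauchy-decomposition inclusion.  Since `W_ℓ(φ)` is a homomorphism of free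
`A_ℓ`-modules generated in degree `a`, it is determined by this degree-`a` component,
so injectivity of `φ ↦ W_ℓ(φ)` is exactly injectivity of
`φ̃ ↦ (1 ⊗ Ψ ⊗ 1) ∘ (Φ ⊗ φ̃)`, which is what we state.

`Φ` and `Ψ` are specified by their (uniquely determining) values on generators.
-/

set_option synthInstance.maxHeartbeats 1000000
set_option maxHeartbeats 1000000

noncomputable section
open TensorProduct

/-- The wedge `v 0 ∧ ⋯ ∧ v (n-1)` as an element of the `n`-th exterior power. -/
def wedge (K : Type) [Field K] {M : Type} [AddCommGroup M] [Module K M] {n : ℕ}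
    (v : Fin n → M) : ⋀[K]^n M :=
  ⟨ExteriorAlgebra.ιMulti K n v, ExteriorAlgebra.ιMulti_range K n (Set.mem_range_self v)⟩

/-- The shuffle permutation of `Fin a` associated to a `b`-element subset `I`. -/
def shufflePerm {a b : ℕ} (I : Finset (Fin a)) (hI : I.card = b) : Equiv.Perm (Fin a) :=
  have hba : b ≤ a := by
    simpa [hI, Fintype.card_fin] using Finset.card_le_univ I
  have hIc : Iᶜ.card = a - b := by
    simp [Finset.card_compl, hI]
  (finCongr (Nat.add_sub_cancel' hba).symm).trans <|
    finSumFinEquiv.symm.trans <|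
      (Equiv.sumCongr (I.orderIsoOfFin hI).toEquiv ((Iᶜ).orderIsoOfFin hIc).toEquiv).trans <|
        (Equiv.sumCongr (Equiv.refl _)
          (Equiv.subtypeEquivRight (fun _ => Finset.mem_compl))).trans
            (Equiv.sumCompl (· ∈ I))

/-- The sign `sgn(I, I')` of the shuffle permutation determined by `I`. -/
def shuffleSign {a b : ℕ} (I : Finset (Fin a)) (hI : I.card = b) : ℤ :=
  Equiv.Perm.sign (shufflePerm I hI)

/-- `v_I`, the wedge of the entries of `v` indexed by `I`, in increasing order. -/
def subWedge (K : Type) [Field K] {M : Type} [AddCommGroup M] [Module K M] {a b : ℕ}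
    (v : Fin a → M) (I : Finset (Fin a)) (hI : I.card = b) : ⋀[K]^b M :=
  wedge K fun j => v (I.orderIsoOfFin hI j)

/-- The submodule of the `m`-th tensor power spanned by the differences `t - σ·t`. -/
def symRel (K : Type) [Field K] (m : ℕ) (U : Type) [AddCommGroup U] [Module K U] :
    Submodule K (⨂[K]^m U) :=
  Submodule.span K {x | ∃ (σ : Equiv.Perm (Fin m)) (t : Fin m → U),
    x = PiTensorProduct.tprod K t - PiTensorProduct.tprod K (t ∘ σ)}

/-- The `m`-th symmetric power `Sym^m U` of a `K`-vector space `U`. -/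
abbrev SymPow (K : Type) [Field K] (m : ℕ) (U : Type) [AddCommGroup U] [Module K U] : Type :=
  (⨂[K]^m U) ⧸ symRel K m U

/-- The class of a pure tensor in the symmetric power. -/
def symMk (K : Type) [Field K] {m : ℕ} {U : Type} [AddCommGroup U] [Module K U]
    (u : Fin m → U) : SymPow K m U :=
  Submodule.Quotient.mk (PiTensorProduct.tprod K u)

theorem wedge_eq_ιMulti (K : Type) [Field K] {M : Type} [AddCommGroup M] [Module K M] {n : ℕ}
    (v : Fin n → M) : wedge K v = exteriorPower.ιMulti K n v := rfl

/-- symmetrized multilinear map -/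
def gMulti (K : Type) [Field K] {m : ℕ} {U V : Type} [AddCommGroup U] [Module K U]
    [AddCommGroup V] [Module K V] (c : Fin m → U →ₗ[K] V) :
    MultilinearMap K (fun _ : Fin m => U) (⋀[K]^m V) :=
  ∑ τ : Equiv.Perm (Fin m),
    (((exteriorPower.ιMulti K m (M := V)).toMultilinearMap.compLinearMap c).domDomCongr τ)

theorem gMulti_apply (K : Type) [Field K] {m : ℕ} {U V : Type} [AddCommGroup U] [Module K U]
    [AddCommGroup V] [Module K V] (c : Fin m → U →ₗ[K] V) (u : Fin m → U) :
    gMulti K c u = ∑ τ : Equiv.Perm (Fin m), exteriorPower.ιMulti K m (fun i => c i (u (τ i))) := by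
  simp [gMulti]

theorem gMulti_perm (K : Type) [Field K] {m : ℕ} {U V : Type} [AddCommGroup U] [Module K U]
    [AddCommGroup V] [Module K V] (c : Fin m → U →ₗ[K] V) (u : Fin m → U)
    (σ : Equiv.Perm (Fin m)) :
    gMulti K c (u ∘ σ) = gMulti K c u := by
  rw [gMulti_apply, gMulti_apply]
  exact Fintype.sum_equiv (Equiv.mulLeft σ) _ _ (fun τ => by simp)

/-- the induced map on the symmetric power -/
def gSym (K : Type) [Field K] {m : ℕ} {U V : Type} [AddCommGroup U] [Module K U]
    [AddCommGroup V] [Module K V] (c : Fin m → U →ₗ[K] V) :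
    SymPow K m U →ₗ[K] ⋀[K]^m V :=
  (symRel K m U).liftQ (PiTensorProduct.lift (gMulti K c)) (by
    rw [symRel, Submodule.span_le]
    rintro x ⟨σ, t, rfl⟩
    simp [gMulti_perm])

theorem gSym_symMk (K : Type) [Field K] {m : ℕ} {U V : Type} [AddCommGroup U] [Module K U]
    [AddCommGroup V] [Module K V] (c : Fin m → U →ₗ[K] V) (u : Fin m → U) :
    gSym K c (symMk K u) = gMulti K c u := by
  unfold gSym symMk
  erw [Submodule.liftQ_apply]
  simp

/-- contraction of the first factor against a coordinate -/
def contr (K : Type) [Field K] (l : ℕ) (V : Type) [AddCommGroup V] [Module K V] (j : Fin l) :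
    ((Fin l → K) ⊗[K] V) →ₗ[K] V :=
  (TensorProduct.lid K V).toLinearMap ∘ₗ (LinearMap.proj (φ := fun _ : Fin l => K) j).rTensor V

theorem contr_tmul (K : Type) [Field K] (l : ℕ) (V : Type) [AddCommGroup V] [Module K V]
    (j : Fin l) (x : Fin l → K) (v : V) : contr K l V j (x ⊗ₜ v) = x j • v := by
  simp [contr]

theorem gSym_psi (K : Type) [Field K] {l m : ℕ} {V : Type}
    [AddCommGroup V] [Module K V] (j : Fin m → Fin l) (hj : Function.Injective j)
    (w : Fin m → V) :
    gSym K (fun i => contr K l V (j i)) (∑ σ : Equiv.Perm (Fin m),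
      (Equiv.Perm.sign σ : ℤ) • symMk K (fun i =>
        (Pi.single (j i) 1 : Fin l → K) ⊗ₜ[K] w (σ i))) = (m.factorial : K) • wedge K w := by
  have key : ∀ σ : Equiv.Perm (Fin m), gSym K (fun i => contr K l V (j i))
      ((Equiv.Perm.sign σ : ℤ) • symMk K (fun i =>
        (Pi.single (j i) 1 : Fin l → K) ⊗ₜ[K] w (σ i))) = wedge K w := by
    intro σ
    rw [map_zsmul, gSym_symMk, gMulti_apply, Finset.sum_eq_single 1]
    · have : (fun i => contr K l V (j i) ((Pi.single (j ((1 : Equiv.Perm (Fin m)) i)) 1 : Fin l → K)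
          ⊗ₜ[K] w (σ ((1 : Equiv.Perm (Fin m)) i)))) = w ∘ σ := by
        funext i
        rw [contr_tmul]
        simp
      rw [this, AlternatingMap.map_perm, wedge_eq_ιMulti]
      rcases Int.units_eq_one_or (Equiv.Perm.sign σ) with h | h <;> simp [h]
    · intro τ _ hτ
      obtain ⟨i, hi⟩ : ∃ i, τ i ≠ i := by
        by_contra! h
        exact hτ (Equiv.ext h)
      apply AlternatingMap.map_coord_zero _ i
      rw [contr_tmul, Pi.single_eq_of_ne, zero_smul]
      exact fun h => hi (hj h).symm
    · simp
  rw [map_sum, Finset.sum_congr rfl (fun σ _ => key σ)]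
  simp [Fintype.card_perm, ← Nat.cast_smul_eq_nsmul K]

/-- the coordinate functional on the exterior power -/
def detFun (K : Type) [Field K] {l b : ℕ} (j : Fin b → Fin l) :
    (⋀[K]^b (Fin l → K)) →ₗ[K] K :=
  exteriorPower.alternatingMapLinearEquiv
    ((Matrix.detRowAlternating (R := K) (n := Fin b)).compLinearMap (LinearMap.funLeft K K j))

theorem detFun_wedge (K : Type) [Field K] {l b : ℕ} (j : Fin b → Fin l) (v : Fin b → Fin l → K) :
    detFun K j (wedge K v) = Matrix.det (Matrix.of fun i k => v i (j k)) := by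
  rw [wedge_eq_ιMulti, detFun, exteriorPower.alternatingMapLinearEquiv_apply_ιMulti]
  rfl

/-- Fix `Φ` (exterior comultiplication) and `Ψ` (the Cauchy inclusion),
characterized by their values on generators.  Then the assignment
`φ̃ ↦ (1 ⊗ Ψ ⊗ 1) ∘ (Φ ⊗ φ̃)`, i.e. `φ ↦ W_ℓ(φ)`, is injective:
if `W_ℓ(φ) = 0` then `φ = 0`. -/
theorem weyman_functor_injective_on_homs
    (K : Type) [Field K] [CharZero K] (N : ℕ)
    (W : Type) [AddCommGroup W] [Module K W] [FiniteDimensional K W]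
    (hW : Module.finrank K W = N + 1)
    (ℓ a b : ℕ) (hℓ1 : 1 ≤ ℓ) (hℓ : ℓ ≤ N) (hba : b ≤ a) (haℓ : a ≤ ℓ)
    (H H' : Type) [AddCommGroup H] [Module K H] [FiniteDimensional K H]
    [AddCommGroup H'] [Module K H'] [FiniteDimensional K H']
    -- the exterior comultiplication `Φ : ⋀^a K^ℓ → ⋀^b K^ℓ ⊗ ⋀^{a-b} K^ℓ`
    (Φ : (⋀[K]^a (Fin ℓ → K)) →ₗ[K]
      ((⋀[K]^b (Fin ℓ → K)) ⊗[K] (⋀[K]^(a - b) (Fin ℓ → K))))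
    (hΦ : ∀ v : Fin a → (Fin ℓ → K),
      Φ (wedge K v) =
        ∑ I : Finset (Fin a),
          if hI : I.card = b then
            shuffleSign I hI •
              (subWedge K v I hI ⊗ₜ[K]
                subWedge K v Iᶜ (by simp [Finset.card_compl, hI]))
          else 0)
    -- the Cauchy inclusion `Ψ : ⋀^{a-b} K^ℓ ⊗ ⋀^{a-b} W* → Sym^{a-b}(K^ℓ ⊗ W*) = (A_ℓ)_{a-b}`
    (Ψ : ((⋀[K]^(a - b) (Fin ℓ → K)) ⊗[K] (⋀[K]^(a - b) (Module.Dual K W))) →ₗ[K]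
      SymPow K (a - b) ((Fin ℓ → K) ⊗[K] Module.Dual K W))
    (hΨ : ∀ (v : Fin (a - b) → (Fin ℓ → K)) (w : Fin (a - b) → Module.Dual K W),
      Ψ (wedge K v ⊗ₜ[K] wedge K w) =
        ∑ σ : Equiv.Perm (Fin (a - b)),
          ((Equiv.Perm.sign σ : ℤ)) • symMk K (fun i => v i ⊗ₜ[K] w (σ i))) :
    Function.Injective
      (fun φ : H →ₗ[K] ((⋀[K]^(a - b) (Module.Dual K W)) ⊗[K] H') =>
        -- `W_ℓ(φ)` in degree `a` : `⋀^a K^ℓ ⊗ H → ⋀^b K^ℓ ⊗ ((A_ℓ)_{a-b} ⊗ H')`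
        (TensorProduct.leftComm K _ _ H').toLinearMap ∘ₗ
          (TensorProduct.map Ψ (LinearMap.id (M := (⋀[K]^b (Fin ℓ → K)) ⊗[K] H'))) ∘ₗ
            ((TensorProduct.congr (TensorProduct.comm K _ _)
                (LinearEquiv.refl K ((⋀[K]^(a - b) (Module.Dual K W)) ⊗[K] H'))).trans
              (TensorProduct.tensorTensorTensorComm K _ _ _ _)).toLinearMap ∘ₗ
              (TensorProduct.map Φ φ)) := by
  obtain ⟨I₀, hI₀⟩ : ∃ I : Finset (Fin a), I.card = b := by
    obtain ⟨I, -, h⟩ := Finset.exists_subset_card_eq (s := (Finset.univ : Finset (Fin a))) (n := b)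
      (by simpa using hba)
    exact ⟨I, h⟩
  have hI₀c : I₀ᶜ.card = a - b := by simp [Finset.card_compl, hI₀]
  let ι : Fin a → Fin ℓ := Fin.castLE haℓ
  have hι : Function.Injective ι := Fin.castLE_injective haℓ
  let e : Fin a → (Fin ℓ → K) := fun i => Pi.single (ι i) 1
  let jb : Fin b → Fin ℓ := fun k => ι (I₀.orderIsoOfFin hI₀ k)
  have hjb : Function.Injective jb :=
    hι.comp (Subtype.val_injective.comp (I₀.orderIsoOfFin hI₀).injective)
  let jm : Fin (a - b) → Fin ℓ := fun k => ι (I₀ᶜ.orderIsoOfFin hI₀c k)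
  have hjm : Function.Injective jm :=
    hι.comp (Subtype.val_injective.comp (I₀ᶜ.orderIsoOfFin hI₀c).injective)
  let f := detFun K jb
  let g := gSym K (fun i => contr K ℓ (Module.Dual K W) (jm i))
  have hf1 : f (subWedge K e I₀ hI₀) = 1 := by
    change detFun K jb (wedge K _) = 1
    rw [detFun_wedge]
    convert Matrix.det_one (n := Fin b) (R := K)
    ext i k
    simp only [Matrix.of_apply, e, Matrix.one_apply, Pi.single_apply]
    congr 1
    exact propext ⟨fun h => (hjb h).symm, fun h => by rw [h]⟩
  have hf0 : ∀ I (hI : I.card = b), I ≠ I₀ → f (subWedge K e I hI) = 0 := by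
    intro I hI hne
    change detFun K jb (wedge K _) = 0
    rw [detFun_wedge]
    obtain ⟨x, hx, hx0⟩ : ∃ x ∈ I, x ∉ I₀ := by
      by_contra! h
      exact hne (Finset.eq_of_subset_of_card_le h (by rw [hI, hI₀]))
    apply Matrix.det_eq_zero_of_row_eq_zero ((I.orderIsoOfFin hI).symm ⟨x, hx⟩)
    intro k
    simp only [Matrix.of_apply, e, OrderIso.apply_symm_apply]
    rw [Pi.single_eq_of_ne]
    intro h
    apply hx0
    rw [← hι h]
    exact (I₀.orderIsoOfFin hI₀ k).2
  have hg : ∀ w, g (Ψ (subWedge K e I₀ᶜ hI₀c ⊗ₜ[K] w)) = ((a - b).factorial : K) • w := by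
    have : g ∘ₗ Ψ ∘ₗ TensorProduct.mk K _ _ (subWedge K e I₀ᶜ hI₀c)
        = ((a - b).factorial : K) • LinearMap.id := by
      apply exteriorPower.linearMap_ext
      ext1 w
      change g (Ψ (wedge K _ ⊗ₜ[K] wedge K w)) = ((a - b).factorial : K) • wedge K w
      rw [hΨ]
      exact gSym_psi K jm hjm w
    exact fun w => LinearMap.congr_fun this w
  intro φ₁ φ₂ hφ
  ext1 h
  have h1 := LinearMap.congr_fun hφ (wedge K e ⊗ₜ[K] h)
  simp only [LinearMap.comp_apply, TensorProduct.map_tmul] at h1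
  let L := (TensorProduct.lid K _).toLinearMap ∘ₗ
    (TensorProduct.map f (TensorProduct.map g (LinearMap.id (M := H')))) ∘ₗ
    (TensorProduct.leftComm K _ _ H').toLinearMap ∘ₗ
          (TensorProduct.map Ψ (LinearMap.id (M := (⋀[K]^b (Fin ℓ → K)) ⊗[K] H'))) ∘ₗ
            ((TensorProduct.congr (TensorProduct.comm K _ _)
                (LinearEquiv.refl K ((⋀[K]^(a - b) (Module.Dual K W)) ⊗[K] H'))).trans
              (TensorProduct.tensorTensorTensorComm K _ _ _ _)).toLinearMap
  have hLp : ∀ p q w (h' : H'), L ((p ⊗ₜ[K] q) ⊗ₜ[K] (w ⊗ₜ[K] h')) =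
      f p • (g (Ψ (q ⊗ₜ[K] w)) ⊗ₜ[K] h') := by
    intro p q w h'
    simp [L]
  have hL : ∀ x, L (Φ (wedge K e) ⊗ₜ[K] x) =
      ((shuffleSign I₀ hI₀ : K) * ((a - b).factorial : K)) • x := by
    intro x
    induction x using TensorProduct.induction_on with
    | zero => simp
    | add x y hx hy => rw [TensorProduct.tmul_add, map_add, hx, hy, smul_add]
    | tmul w h' =>
      rw [hΦ, TensorProduct.sum_tmul, map_sum, Finset.sum_eq_single I₀]
      · rw [dif_pos hI₀, ← Int.cast_smul_eq_zsmul K, ← TensorProduct.smul_tmul', map_smul, hLp,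
          hf1, hg, one_smul, ← TensorProduct.smul_tmul', mul_smul]
      · intro I _ hne
        by_cases hI : I.card = b
        · rw [dif_pos hI, ← Int.cast_smul_eq_zsmul K, ← TensorProduct.smul_tmul', map_smul, hLp,
            hf0 I hI hne, zero_smul, smul_zero]
        · rw [dif_neg hI, TensorProduct.zero_tmul, map_zero]
      · simp
  have h2 : L (Φ (wedge K e) ⊗ₜ[K] φ₁ h) = L (Φ (wedge K e) ⊗ₜ[K] φ₂ h) :=
    congrArg (fun z => TensorProduct.lid K _
      (TensorProduct.map f (TensorProduct.map g (LinearMap.id (M := H'))) z)) h1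
  rw [hL, hL] at h2
  refine smul_right_injective _ ?_ h2
  apply mul_ne_zero
  · simp [shuffleSign]
  · exact_mod_cast Nat.factorial_ne_zero (a - b)

end
end

section
/- Let K be a field of characteristic 0, W a K-vector space of dimension ℓ (here playing the role of K^ℓ), and V a K-vector space. For each m ≥ 0, the map Ψ : ⋀^m K^ℓ ⊗ ⋀^m V → Sym^m(K^ℓ ⊗ V) given by v_1 ∧ ⋯ ∧ v_m ⊗ w_1 ∧ ⋯ ∧ w_m ↦ Σ_{σ ∈ S_m} sgn(σ) (v_1 ⊗ w_{σ(1)})⋯(v_m ⊗ w_{σ(m)}) is a well-defined injective K-linear map. -/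
/-!
Statement 2 (Cox–Materov, "Tate Resolutions and Weyman Complexes").

Let `K` be a field of characteristic `0`, `U` a `K`-vector space of dimension `ℓ`
(playing the role of `K^ℓ`), and `V` a `K`-vector space.  For each `m ≥ 0` the map
`Ψ : ⋀^m U ⊗ ⋀^m V → Sym^m (U ⊗ V)`,
`v₁ ∧ ⋯ ∧ v_m ⊗ w₁ ∧ ⋯ ∧ w_m ↦ ∑_{σ ∈ S_m} sgn(σ) (v₁ ⊗ w_{σ(1)}) ⋯ (v_m ⊗ w_{σ(m)})`,
is a well-defined injective `K`-linear map.

Here the `m`-th symmetric power `Sym^m U` is realized as the quotient of the `m`-th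
tensor power by the span of the differences `t - σ·t`; the class of a pure tensor is
the corresponding product in the symmetric algebra.
-/

noncomputable section
open TensorProduct

section helpers

variable (K : Type) [Field K] (U : Type) [AddCommGroup U] [Module K U]
  (V : Type) [AddCommGroup V] [Module K V] (m : ℕ)

/-- The linear map `u ⊗ v ↦ ι u ⊗ ι v`. -/
def auxF : U ⊗[K] V →ₗ[K] ExteriorAlgebra K U ⊗[K] ExteriorAlgebra K V :=
  TensorProduct.map (ExteriorAlgebra.ι K) (ExteriorAlgebra.ι K)

lemma auxF_commute (x y : U ⊗[K] V) : Commute (auxF K U V x) (auxF K U V y) := by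
  induction x using TensorProduct.induction_on with
  | zero => simp
  | add a b ha hb => rw [map_add]; exact ha.add_left hb
  | tmul u v =>
    induction y using TensorProduct.induction_on with
    | zero => simp
    | add a b ha hb => rw [map_add]; exact ha.add_right hb
    | tmul u' v' =>
      simp only [auxF, TensorProduct.map_tmul, commute_iff_eq,
        Algebra.TensorProduct.tmul_mul_tmul]
      rw [eq_neg_of_add_eq_zero_left (ExteriorAlgebra.ι_add_mul_swap u u'),
        eq_neg_of_add_eq_zero_left (ExteriorAlgebra.ι_add_mul_swap v v'),
        TensorProduct.neg_tmul, TensorProduct.tmul_neg, neg_neg]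

/-- The multilinear product map on the tensor power. -/
def auxG : (⨂[K]^m (U ⊗[K] V)) →ₗ[K] ExteriorAlgebra K U ⊗[K] ExteriorAlgebra K V :=
  PiTensorProduct.lift ((MultilinearMap.mkPiAlgebraFin K m
    (ExteriorAlgebra K U ⊗[K] ExteriorAlgebra K V)).compLinearMap fun _ => auxF K U V)

lemma auxG_tprod (t : Fin m → U ⊗[K] V) :
    auxG K U V m (PiTensorProduct.tprod K t) = (List.ofFn fun i => auxF K U V (t i)).prod := by
  simp [auxG]

lemma symRel_le_ker : symRel K m (U ⊗[K] V) ≤ LinearMap.ker (auxG K U V m) := by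
  refine Submodule.span_le.2 ?_
  rintro x ⟨σ, t, rfl⟩
  rw [SetLike.mem_coe, LinearMap.mem_ker, map_sub, auxG_tprod, auxG_tprod, sub_eq_zero]
  symm
  apply (σ.ofFn_comp_perm fun i => auxF K U V (t i)).prod_eq'
  rw [List.pairwise_ofFn]
  intro i j _
  exact auxF_commute K U V _ _

/-- The map `Sym^m (U ⊗ V) → ⋀ U ⊗ ⋀ V`. -/
def auxΦ : SymPow K m (U ⊗[K] V) →ₗ[K] ExteriorAlgebra K U ⊗[K] ExteriorAlgebra K V :=
  (symRel K m (U ⊗[K] V)).liftQ (auxG K U V m) (symRel_le_ker K U V m)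

lemma prod_ofFn_tmul (A B : Type) [Ring A] [Ring B] [Algebra K A] [Algebra K B]
    (a : Fin m → A) (b : Fin m → B) :
    (List.ofFn fun i => a i ⊗ₜ[K] b i).prod = (List.ofFn a).prod ⊗ₜ[K] (List.ofFn b).prod := by
  induction m with
  | zero => simp [Algebra.TensorProduct.one_def]
  | succ n ih => simp [List.ofFn_succ, ih]

lemma auxΦ_symMk (v : Fin m → U) (w : Fin m → V) :
    auxΦ K U V m (symMk K fun i => v i ⊗ₜ[K] w i) =
      ExteriorAlgebra.ιMulti K m v ⊗ₜ[K] ExteriorAlgebra.ιMulti K m w := by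
  rw [auxΦ, symMk, Submodule.liftQ_apply, auxG_tprod]
  simp only [auxF, TensorProduct.map_tmul, ExteriorAlgebra.ιMulti_apply]
  exact prod_ofFn_tmul K m _ _ _ _

/-- The map `m! Ψ`. -/
def auxΨ : ((⋀[K]^m U) ⊗[K] (⋀[K]^m V)) →ₗ[K] SymPow K m (U ⊗[K] V) :=
  (symRel K m (U ⊗[K] V)).mkQ ∘ₗ
    TensorProduct.lift ((PiTensorProduct.map₂ fun _ => TensorProduct.mk K U V).compl₁₂
      (exteriorPower.toTensorPower K U m) (exteriorPower.toTensorPower K V m))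

lemma symMk_comp {W : Type} [AddCommGroup W] [Module K W] (t : Fin m → W)
    (σ : Equiv.Perm (Fin m)) : symMk K (fun i => t (σ i)) = symMk K t := by
  symm
  exact (Submodule.Quotient.eq _).2 (Submodule.subset_span ⟨σ, t, rfl⟩)

lemma auxΨ_apply (v : Fin m → U) (w : Fin m → V) :
    auxΨ K U V m (wedge K v ⊗ₜ[K] wedge K w) =
      (m.factorial : K) • ∑ σ : Equiv.Perm (Fin m),
            ((Equiv.Perm.sign σ : ℤ)) • symMk K (fun i => v i ⊗ₜ[K] w (σ i)) := by
  have key : auxΨ K U V m (wedge K v ⊗ₜ[K] wedge K w) =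
      ∑ σ : Equiv.Perm (Fin m), ∑ τ : Equiv.Perm (Fin m),
        (Equiv.Perm.sign σ : ℤ) • (Equiv.Perm.sign τ : ℤ) •
          symMk K (fun i => v (σ i) ⊗ₜ[K] w (τ i)) := by
    change (symRel K m (U ⊗[K] V)).mkQ (PiTensorProduct.map₂ (fun _ => TensorProduct.mk K U V)
      (exteriorPower.toTensorPower K U m (exteriorPower.ιMulti K m v))
      (exteriorPower.toTensorPower K V m (exteriorPower.ιMulti K m w))) = _
    simp only [exteriorPower.toTensorPower_apply_ιMulti, Units.smul_def,
      ← Int.cast_smul_eq_zsmul K, map_sum, map_smul,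
      LinearMap.sum_apply, LinearMap.smul_apply, PiTensorProduct.map₂_tprod_tprod,
      Finset.smul_sum]
    rw [Finset.sum_comm]
    refine Finset.sum_congr rfl fun σ _ => Finset.sum_congr rfl fun τ _ => ?_
    rw [smul_comm]
    rfl
  rw [key]
  have h : ∀ σ : Equiv.Perm (Fin m), (∑ τ : Equiv.Perm (Fin m),
        (Equiv.Perm.sign σ : ℤ) • (Equiv.Perm.sign τ : ℤ) •
          symMk K (fun i => v (σ i) ⊗ₜ[K] w (τ i))) =
      ∑ τ : Equiv.Perm (Fin m),
        (Equiv.Perm.sign τ : ℤ) • symMk K (fun i => v i ⊗ₜ[K] w (τ i)) := by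
    intro σ
    rw [← Equiv.sum_comp (Equiv.mulRight σ)]
    refine Finset.sum_congr rfl fun τ _ => ?_
    have := symMk_comp K m (fun i => v i ⊗ₜ[K] w (τ i)) σ
    simp only [Equiv.coe_mulRight, Equiv.Perm.mul_apply, this, Equiv.Perm.sign_mul, smul_smul]
    congr 1
    rw [Units.val_mul, mul_comm, mul_assoc, ← Units.val_mul, Int.units_mul_self]
    simp
  rw [Finset.sum_congr rfl fun σ _ => h σ, Finset.sum_const, Finset.card_univ,
    Fintype.card_perm, Fintype.card_fin, Nat.cast_smul_eq_nsmul]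

end helpers

/-- The map `Ψ : ⋀^m U ⊗ ⋀^m V → Sym^m (U ⊗ V)` given on generators by
`v ⊗ w ↦ ∑_σ sgn(σ) ∏ᵢ (vᵢ ⊗ w_{σ(i)})` is a well-defined injective `K`-linear map. -/
theorem cauchy_component_injective
    (K : Type) [Field K] [CharZero K] (ℓ : ℕ)
    (U : Type) [AddCommGroup U] [Module K U] [FiniteDimensional K U]
    (hU : Module.finrank K U = ℓ)
    (V : Type) [AddCommGroup V] [Module K V]
    (m : ℕ) :
    ∃ Ψ : ((⋀[K]^m U) ⊗[K] (⋀[K]^m V)) →ₗ[K] SymPow K m (U ⊗[K] V),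
      (∀ (v : Fin m → U) (w : Fin m → V),
        Ψ (wedge K v ⊗ₜ[K] wedge K w) =
          ∑ σ : Equiv.Perm (Fin m),
            ((Equiv.Perm.sign σ : ℤ)) • symMk K (fun i => v i ⊗ₜ[K] w (σ i))) ∧
      Function.Injective Ψ := by
  have hm : (m.factorial : K) ≠ 0 := Nat.cast_ne_zero.2 m.factorial_ne_zero
  have hΨ : ∀ (v : Fin m → U) (w : Fin m → V),
      ((m.factorial : K)⁻¹ • auxΨ K U V m) (wedge K v ⊗ₜ[K] wedge K w) =
          ∑ σ : Equiv.Perm (Fin m),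
            ((Equiv.Perm.sign σ : ℤ)) • symMk K (fun i => v i ⊗ₜ[K] w (σ i)) := by
    intro v w
    rw [LinearMap.smul_apply, auxΨ_apply, inv_smul_smul₀ hm]
  refine ⟨(m.factorial : K)⁻¹ • auxΨ K U V m, hΨ, ?_⟩
  generalize (m.factorial : K)⁻¹ • auxΨ K U V m = Ψ at hΨ
  have hcomp : auxΦ K U V m ∘ₗ Ψ = (m.factorial : K) •
      TensorProduct.map (⋀[K]^m U).subtype (⋀[K]^m V).subtype := by
    apply TensorProduct.ext
    apply exteriorPower.linearMap_ext
    ext v : 1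
    apply exteriorPower.linearMap_ext
    ext w : 1
    change auxΦ K U V m (Ψ (wedge K v ⊗ₜ[K] wedge K w)) = (m.factorial : K) •
      (ExteriorAlgebra.ιMulti K m v ⊗ₜ[K] ExteriorAlgebra.ιMulti K m w)
    rw [hΨ, map_sum]
    have h : ∀ σ : Equiv.Perm (Fin m), auxΦ K U V m
        (((Equiv.Perm.sign σ : ℤ)) • symMk K (fun i => v i ⊗ₜ[K] w (σ i))) =
        ExteriorAlgebra.ιMulti K m v ⊗ₜ[K] ExteriorAlgebra.ιMulti K m w := by
      intro σ
      rw [map_zsmul, auxΦ_symMk K U V m v (fun i => w (σ i))]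
      have := (ExteriorAlgebra.ιMulti K m).map_perm w σ
      rw [Function.comp_def] at this
      rw [this, Units.smul_def, TensorProduct.tmul_smul, smul_smul, ← Units.val_mul,
        Int.units_mul_self]
      simp
    rw [Finset.sum_congr rfl fun σ _ => h σ, Finset.sum_const, Finset.card_univ,
      Fintype.card_perm, Fintype.card_fin, Nat.cast_smul_eq_nsmul]
  have hinj : Function.Injective (auxΦ K U V m ∘ₗ Ψ) := by
    rw [hcomp]
    exact (smul_right_injective _ hm).comp (TensorProduct.map_injective_of_flat_flat _ _
      (Submodule.subtype_injective _) (Submodule.subtype_injective _))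
  rw [LinearMap.coe_comp] at hinj
  exact hinj.of_comp

end
end
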